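/- arXiv:0905.3960 — 3 statements merged into one kernel-verified Lean document; each statement's English description precedes it below -/
import Mathlib

section
/- Let G be a countable group acting by automorphisms on a countable group W, and let ψ be a W-invariant, G-equivariant 𝒜-gauge on W, where 𝒜 is the set of finite subsets of G. Assume there exists a G-invariant conditionally negative definite function u on W (u(g·w) = u(w)) such that, for every finite subset F ⊆ G, the restriction of u to W_F := {w ∈ W : ψ(w) ⊆ F} is proper (i.e. {w ∈ W_F : u(w) ≤ R} is finite for every R). Then W ⋊ G admits a proper conditionally negative definite function if and only if G does. -/
open MeasureTheory Function Set
open scoped ENNReal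
/-- A conditionally negative definite kernel: symmetric, vanishing on the diagonal,
with `∑ᵢⱼ cᵢcⱼ κ(xᵢ,xⱼ) ≤ 0` whenever `∑ᵢ cᵢ = 0`. -/
def IsCNDKernel {X : Type*} (κ : X → X → ℝ) : Prop :=
  (∀ x y, κ x y = κ y x) ∧ (∀ x, κ x x = 0) ∧
    ∀ (n : ℕ) (x : Fin n → X) (c : Fin n → ℝ), (∑ i, c i) = 0 →
      ∑ i, ∑ j, c i * c j * κ (x i) (x j) ≤ 0

/-- A conditionally negative definite function on a group. -/
def IsCNDFunction {G : Type*} [Group G] (ψ : G → ℝ) : Prop :=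
  IsCNDKernel fun g h => ψ (g⁻¹ * h)

/-- A proper function on a group: sublevel sets are finite. -/
def IsProperFunction {G : Type*} [Group G] (ψ : G → ℝ) : Prop :=
  ∀ R : ℝ, {g : G | ψ g ≤ R}.Finite

open ProbabilityTheory

theorem IsCNDKernel.sum_nonpos {X ι : Type*} [Fintype ι] {κ : X → X → ℝ} (hκ : IsCNDKernel κ)
    (x : ι → X) (c : ι → ℝ) (hc : ∑ i, c i = 0) :
    ∑ i, ∑ j, c i * c j * κ (x i) (x j) ≤ 0 := by
  let e := (Fintype.equivFin ι).symm
  have h := hκ.2.2 _ (x ∘ e) (c ∘ e) (by rw [← hc]; exact Equiv.sum_comp e c)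
  convert h using 1
  rw [← Equiv.sum_comp e]
  refine Finset.sum_congr rfl fun i _ => ?_
  rw [← Equiv.sum_comp e]
  rfl

theorem IsCNDKernel.add {X : Type*} {κ κ' : X → X → ℝ} (hκ : IsCNDKernel κ)
    (hκ' : IsCNDKernel κ') : IsCNDKernel fun x y => κ x y + κ' x y := by
  refine ⟨fun x y => congrArg₂ _ (hκ.1 x y) (hκ'.1 x y), fun x => by simp [hκ.2.1, hκ'.2.1],
    fun n x c hc => ?_⟩
  simpa only [mul_add, Finset.sum_add_distrib] using
    add_nonpos (hκ.2.2 n x c hc) (hκ'.2.2 n x c hc)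

theorem IsCNDKernel.comp {X Y : Type*} {κ : X → X → ℝ} (hκ : IsCNDKernel κ) (p : Y → X) :
    IsCNDKernel fun x y => κ (p x) (p y) :=
  ⟨fun _ _ => hκ.1 _ _, fun _ => hκ.2.1 _, fun n x c hc => hκ.2.2 n (p ∘ x) c hc⟩

theorem IsCNDFunction.apply_one {G : Type*} [Group G] {f : G → ℝ} (hf : IsCNDFunction f) :
    f 1 = 0 := by
  simpa using hf.2.1 1

theorem IsCNDFunction.apply_inv {G : Type*} [Group G] {f : G → ℝ} (hf : IsCNDFunction f)
    (g : G) : f g⁻¹ = f g := by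
  simpa using hf.1 g 1

theorem IsCNDFunction.nonneg {G : Type*} [Group G] {f : G → ℝ} (hf : IsCNDFunction f)
    (g : G) : 0 ≤ f g := by
  have h := hf.2.2 2 ![1, g] ![1, -1] (by simp)
  simp [Fin.sum_univ_two, hf.apply_one, hf.apply_inv] at h
  linarith

theorem IsCNDFunction.comp_hom {G H : Type*} [Group G] [Group H] {f : G → ℝ}
    (hf : IsCNDFunction f) (φ : H →* G) : IsCNDFunction (f ∘ φ) := by
  simpa [IsCNDFunction] using IsCNDKernel.comp hf φ

/-- The indicator of a partial equivalence relation is positive semidefinite. -/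
theorem sum_indicator_partialEquiv_nonneg {ι : Type*} [Fintype ι] (r : ι → ι → Prop)
    [DecidableRel r] (hs : ∀ i j, r i j → r j i) (ht : ∀ i j k, r i j → r j k → r i k)
    (c : ι → ℝ) : 0 ≤ ∑ i, ∑ j, c i * c j * (if r i j then 1 else 0) := by
  classical
  let S : ι → Finset ι := fun i => {k | r i k}
  have hS : ∀ i j, r i j ↔ r i i ∧ r j j ∧ S i = S j := by
    refine fun i j => ⟨fun h => ⟨ht _ _ _ h (hs _ _ h), ht _ _ _ (hs _ _ h) h, ?_⟩, ?_⟩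
    · ext k
      simpa [S] using ⟨ht _ _ _ (hs _ _ h), ht _ _ _ h⟩
    · rintro ⟨-, h, hij⟩
      have : j ∈ S i := by simpa [hij, S] using h
      simpa [S] using this
  have key : ∑ i, ∑ j, c i * c j * (if r i j then (1 : ℝ) else 0) =
      ∑ A : Finset ι, (∑ i, if r i i ∧ S i = A then c i else 0) ^ 2 := by
    simp_rw [sq, Finset.sum_mul_sum]
    symm
    rw [Finset.sum_comm]
    refine Finset.sum_congr rfl fun i _ => ?_
    rw [Finset.sum_comm]
    refine Finset.sum_congr rfl fun j _ => ?_
    rw [Finset.sum_eq_single (S i) (fun A _ hA => by simp [hA.symm]) (by simp)]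
    simp only [hS i j, eq_comm (a := S j)]
    by_cases hi : r i i <;> by_cases hj : r j j <;> by_cases hij : S i = S j <;>
      simp [hi, hj, hij]
  rw [key]
  exact Finset.sum_nonneg fun A _ => sq_nonneg _

/-- A symmetric function satisfying the ultrametric inequality is conditionally negative
definite. -/
theorem sum_nonpos_of_le_max {ι : Type*} [Fintype ι] (δ : ι → ι → ℝ)
    (hs : ∀ i j, δ i j = δ j i) (ht : ∀ i j k, δ i k ≤ max (δ i j) (δ j k))
    (c : ι → ℝ) (hc : ∑ i, c i = 0) : ∑ i, ∑ j, c i * c j * δ i j ≤ 0 := by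
  classical
  obtain ⟨M, hM⟩ : ∃ M, ∀ i j, δ i j ≤ M := by
    obtain ⟨M, hM⟩ := (Set.finite_range fun p : ι × ι => δ p.1 p.2).bddAbove
    exact ⟨M, fun i j => hM ⟨(i, j), rfl⟩⟩
  obtain ⟨m, hm⟩ : ∃ m, ∀ i j, m ≤ δ i j := by
    obtain ⟨m, hm⟩ := (Set.finite_range fun p : ι × ι => δ p.1 p.2).bddBelow
    exact ⟨m, fun i j => hm ⟨(i, j), rfl⟩⟩
  have hint : ∀ i j, Integrable (fun t => if δ i j ≤ t then (1 : ℝ) else 0)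
      (volume.restrict (Icc m M)) := fun i j => by
    refine (integrable_const (1 : ℝ)).mono'
      (Measurable.aestronglyMeasurable ?_) (ae_of_all _ fun t => ?_)
    · exact Measurable.ite measurableSet_Ici measurable_const measurable_const
    · split_ifs <;> simp
  have hval : ∀ i j, ∫ t in Icc m M, (if δ i j ≤ t then (1 : ℝ) else 0) = M - δ i j := by
    intro i j
    have : (fun t => if δ i j ≤ t then (1 : ℝ) else 0) = (Ici (δ i j)).indicator 1 := by
      ext t; simp [indicator_apply]
    rw [this, integral_indicator_one measurableSet_Ici, measureReal_restrict_apply measurableSet_Ici,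
      show Ici (δ i j) ∩ Icc m M = Icc (δ i j) M by
        ext t; simp only [mem_inter_iff, mem_Ici, mem_Icc]
        exact ⟨fun h => ⟨h.1, h.2.2⟩, fun h => ⟨h.1, (hm i j).trans h.1, h.2⟩⟩,
      Real.volume_real_Icc_of_le (hM i j)]
  have hpos : 0 ≤ ∑ i, ∑ j, c i * c j * (M - δ i j) := by
    have : ∑ i, ∑ j, c i * c j * (M - δ i j) =
        ∫ t in Icc m M, ∑ i, ∑ j, c i * c j * (if δ i j ≤ t then (1 : ℝ) else 0) := by
      rw [integral_finsetSum _ fun i _ => integrable_finsetSum _ fun j _ =>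
        (hint i j).const_mul _]
      refine Finset.sum_congr rfl fun i _ => ?_
      rw [integral_finsetSum _ fun j _ => (hint i j).const_mul _]
      refine Finset.sum_congr rfl fun j _ => ?_
      rw [integral_const_mul, hval]
    rw [this]
    refine integral_nonneg fun t => sum_indicator_partialEquiv_nonneg (fun i j => δ i j ≤ t)
      (fun i j h => hs i j ▸ h) (fun i j k h h' => (ht i j k).trans (max_le h h')) c
  have hM0 : ∑ i, ∑ j, c i * c j * M = 0 := by
    simp_rw [← Finset.sum_mul, ← Finset.mul_sum, hc, mul_zero, Finset.sum_const_zero, zero_mul]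
  simp only [mul_sub, Finset.sum_sub_distrib, hM0] at hpos
  linarith

theorem measurePreserving_multivariateGaussian_zero {ι κ : Type*} [Fintype ι] [DecidableEq ι]
    [Fintype κ] [DecidableEq κ] {S : Matrix ι ι ℝ} {S' : Matrix κ κ ℝ} (hS' : S'.PosSemidef)
    (L : EuclideanSpace ℝ ι →L[ℝ] EuclideanSpace ℝ κ)
    (h : ∀ i j, cov[fun x => L x i, fun x => L x j; multivariateGaussian 0 S] = S' i j) :
    MeasurePreserving L (multivariateGaussian 0 S) (multivariateGaussian 0 S') where
  measurable := by fun_prop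
  map_eq := by
    apply IsGaussian.ext
    · simp only [id_eq, integral_id_multivariateGaussian]
      rw [ContinuousLinearMap.integral_id_map, integral_id_multivariateGaussian, map_zero]
      exact IsGaussian.integrable_id
    rw [← ContinuousLinearMap.toBilinForm_inj]
    refine LinearMap.BilinForm.ext_basis (EuclideanSpace.basisFun κ ℝ).toBasis fun i j => ?_
    rw [ContinuousLinearMap.toBilinForm_apply, ContinuousLinearMap.toBilinForm_apply,
      covarianceBilin_apply_eq_cov, covariance_map]
    · have (i : κ) : (fun u => inner ℝ ((EuclideanSpace.basisFun κ ℝ).toBasis i) u) ∘ L =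
          fun u => L u i := by ext; simp [PiLp.inner_apply]
      simp_rw [this, h, covarianceBilin_multivariateGaussian hS']
      simp
    any_goals exact Measurable.aestronglyMeasurable (by fun_prop)
    · fun_prop
    · exact IsGaussian.memLp_two_id

theorem memLp_eval_multivariateGaussian {ι : Type*} [Fintype ι] [DecidableEq ι]
    (μ : EuclideanSpace ℝ ι) (S : Matrix ι ι ℝ) (i : ι) :
    MemLp (fun x => x i) 2 (multivariateGaussian μ S) :=
  IsGaussian.memLp_two_id.mono (Measurable.aestronglyMeasurable (by fun_prop))
    (ae_of_all _ fun x => PiLp.norm_apply_le x i)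

theorem integrable_eval_multivariateGaussian {ι : Type*} [Fintype ι] [DecidableEq ι]
    (μ : EuclideanSpace ℝ ι) (S : Matrix ι ι ℝ) (i : ι) :
    Integrable (fun x => x i) (multivariateGaussian μ S) :=
  (memLp_eval_multivariateGaussian μ S i).integrable one_le_two

theorem integral_eval_multivariateGaussian_zero {ι : Type*} [Fintype ι] [DecidableEq ι]
    (S : Matrix ι ι ℝ) (i : ι) : ∫ x, x i ∂multivariateGaussian 0 S = 0 := by
  have h := (EuclideanSpace.proj i : EuclideanSpace ℝ ι →L[ℝ] ℝ).integral_comp_id_comm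
    (IsGaussian.integrable_id (μ := multivariateGaussian 0 S))
  simpa using h

/-- The covariance matrix on `T` of the centred Gaussian process `X` with `X 1 = 0` and
`𝔼 (X s - X t) ^ 2 = f (s⁻¹ * t)`. -/
noncomputable def schoenbergMatrix {G : Type*} [Group G] (f : G → ℝ) (T : Finset G) :
    Matrix T T ℝ :=
  fun s t => (f s + f t - f ((s : G)⁻¹ * t)) / 2

theorem IsCNDFunction.posSemidef_schoenbergMatrix {G : Type*} [Group G] {f : G → ℝ}
    (hf : IsCNDFunction f) (T : Finset G) : (schoenbergMatrix f T).PosSemidef := by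
  refine Matrix.PosSemidef.of_dotProduct_mulVec_nonneg ?_ fun c => ?_
  · ext s t
    have : f ((t : G)⁻¹ * s) = f ((s : G)⁻¹ * t) := hf.1 _ _
    simp [schoenbergMatrix, this, add_comm]
  · have h := IsCNDKernel.sum_nonpos hf
      (fun o : Option T => o.elim 1 fun t => (t : G))
      (fun o => o.elim (-∑ t, c t) c) (by simp [Fintype.sum_option])
    simp only [Fintype.sum_option, Option.elim_none, Option.elim_some, inv_one, one_mul, mul_one,
      hf.apply_one, hf.apply_inv, mul_zero, zero_add, Finset.sum_add_distrib] at h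
    have h1 : ∑ i, -(∑ t, c t) * c i * f i = -((∑ t, c t) * ∑ i, c i * f i) := by
      simp only [neg_mul, Finset.sum_neg_distrib, Finset.mul_sum, mul_assoc]
    have h2 : ∑ i, c i * -(∑ t, c t) * f i = -((∑ t, c t) * ∑ i, c i * f i) := by
      rw [← h1]; exact Finset.sum_congr rfl fun i _ => by ring
    have h3 : star c ⬝ᵥ Matrix.mulVec (schoenbergMatrix f T) c =
        (∑ t, c t) * (∑ i, c i * f i)
          - (∑ i, ∑ j, c i * c j * f ((i : G)⁻¹ * j)) / 2 := by
      have e1 : (∑ t, c t) * (∑ i, c i * f i) =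
          ∑ i, ∑ j, (c i * (c j * f j) / 2 + c i * f i * c j / 2) := by
        simp only [Finset.sum_add_distrib, ← Finset.sum_div, ← Finset.sum_mul_sum]
        ring
      rw [e1, Finset.sum_div, ← Finset.sum_sub_distrib]
      simp only [dotProduct, Matrix.mulVec, Finset.mul_sum, schoenbergMatrix, star_trivial]
      refine Finset.sum_congr rfl fun i _ => ?_
      rw [Finset.sum_div, ← Finset.sum_sub_distrib]
      exact Finset.sum_congr rfl fun j _ => by ring
    rw [h1, h2] at h
    rw [h3]
    linarith

/-- The expected maximum over `T` of the Gaussian process with increments of variance `f`. -/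
noncomputable def gaussianMax {G : Type*} [Group G] [DecidableEq G] (f : G → ℝ)
    (T : Finset G) : ℝ :=
  ∫ x, ⨆ t, x t ∂multivariateGaussian 0 (schoenbergMatrix f T)

theorem integrable_iSup_multivariateGaussian {ι κ : Type*} [Fintype ι] [DecidableEq ι]
    [Finite κ] [Nonempty κ] (μ : EuclideanSpace ℝ ι) (S : Matrix ι ι ℝ) (e : κ → ι) :
    Integrable (fun x => ⨆ k, x (e k)) (multivariateGaussian μ S) := by
  refine (IsGaussian.integrable_id (μ := multivariateGaussian μ S)).mono
    (Measurable.aestronglyMeasurable ?_) (ae_of_all _ fun x => ?_)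
  · exact Measurable.iSup fun k => by fun_prop
  · rw [Real.norm_eq_abs, abs_le]
    have hx : ∀ i, |x i| ≤ ‖x‖ := fun i => PiLp.norm_apply_le x i
    refine ⟨?_, ciSup_le fun k => (le_abs_self _).trans (hx _)⟩
    obtain ⟨k⟩ := ‹Nonempty κ›
    exact (abs_le.1 (hx (e k))).1.trans
      (le_ciSup (f := fun k => x (e k)) (Set.finite_range _).bddAbove k)

theorem integral_iSup_eq_gaussianMax {G : Type*} [Group G] [DecidableEq G] {f : G → ℝ}
    (hf : IsCNDFunction f) {T U : Finset G} (h : T ⊆ U) (hT : T.Nonempty) :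
    ∫ x, ⨆ t : T, x ⟨t, h t.2⟩ ∂multivariateGaussian 0 (schoenbergMatrix f U) =
      gaussianMax f T := by
  have : Nonempty T := hT.to_subtype
  have hp : MeasurePreserving (EuclideanSpace.restrict₂ h)
      (multivariateGaussian 0 (schoenbergMatrix f U))
      (multivariateGaussian 0 (schoenbergMatrix f T)) := by
    convert measurePreserving_restrict₂_multivariateGaussian (μ := 0)
      (hf.posSemidef_schoenbergMatrix U) h
    · exact (map_zero _).symm
    · rfl
  rw [gaussianMax, ← hp.map_eq, integral_map hp.measurable.aemeasurable]
  · simp only [EuclideanSpace.restrict₂_apply]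
  · exact Measurable.aestronglyMeasurable (Measurable.iSup fun k => by fun_prop)

theorem gaussianMax_singleton {G : Type*} [Group G] [DecidableEq G] (f : G → ℝ) (g : G) :
    gaussianMax f {g} = 0 := by
  rw [gaussianMax]
  simp only [ciSup_unique]
  exact integral_eval_multivariateGaussian_zero _ _

theorem gaussianMax_image_mul_left {G : Type*} [Group G] [DecidableEq G] {f : G → ℝ}
    (hf : IsCNDFunction f) (g : G) {T : Finset G} (hT : T.Nonempty) :
    gaussianMax f (T.image (g * ·)) = gaussianMax f T := by
  have : Nonempty T := hT.to_subtype
  set V := T.image (g * ·) with hV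
  have hVU : V ⊆ insert g V := Finset.subset_insert _ _
  rw [← integral_iSup_eq_gaussianMax hf hVU (hT.image _)]
  let b : (insert g V : Finset G) := ⟨g, Finset.mem_insert_self _ _⟩
  let e : T → (insert g V : Finset G) :=
    fun t => ⟨g * t, hVU (Finset.mem_image_of_mem _ t.2)⟩
  let S := schoenbergMatrix f (insert g V)
  have hS : S.PosSemidef := hf.posSemidef_schoenbergMatrix _
  let L : EuclideanSpace ℝ (insert g V : Finset G) →L[ℝ] EuclideanSpace ℝ T :=
    LinearMap.toContinuousLinearMap
      { toFun x := WithLp.toLp 2 fun t => x (e t) - x b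
        map_add' x y := by ext t; simp; ring
        map_smul' c x := by ext t; simp; ring }
  have hL : ∀ x t, L x t = x (e t) - x b := fun _ _ => rfl
  have hp : MeasurePreserving L (multivariateGaussian 0 S)
      (multivariateGaussian 0 (schoenbergMatrix f T)) := by
    refine measurePreserving_multivariateGaussian_zero (hf.posSemidef_schoenbergMatrix T) L
      fun s t => ?_
    have hm := memLp_eval_multivariateGaussian 0 S
    simp only [hL]
    rw [covariance_fun_sub_fun_sub (hm _) (hm _) (hm _) (hm _)]
    simp only [covariance_eval_multivariateGaussian hS]
    simp only [S, e, b, schoenbergMatrix, mul_inv_rev, inv_mul_cancel, inv_mul_cancel_left,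
      hf.apply_one, mul_assoc, mul_one, hf.apply_inv]
    ring
  have hsup : ∀ x : EuclideanSpace ℝ (insert g V : Finset G),
      ⨆ v : V, x ⟨v, hVU v.2⟩ = (⨆ t, L x t) + x b := by
    intro x
    have hbij : Surjective fun t : T => (⟨g * t, Finset.mem_image_of_mem _ t.2⟩ : V) := by
      rintro ⟨v, hv⟩
      obtain ⟨t, ht, rfl⟩ := Finset.mem_image.1 hv
      exact ⟨⟨t, ht⟩, rfl⟩
    rw [← hbij.iSup_comp, ciSup_add (Set.finite_range _).bddAbove]
    simp only [hL, sub_add_cancel, e]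
  simp_rw [hsup]
  rw [integral_add _ (integrable_eval_multivariateGaussian _ _ _),
    integral_eval_multivariateGaussian_zero, add_zero, gaussianMax, ← hp.map_eq,
    integral_map hp.measurable.aemeasurable]
  · exact Measurable.aestronglyMeasurable (Measurable.iSup fun k => by fun_prop)
  · exact hp.integrable_comp_of_integrable
      (integrable_iSup_multivariateGaussian 0 (schoenbergMatrix f T) id)

theorem integral_abs_eval_multivariateGaussian_zero {ι : Type*} [Fintype ι] [DecidableEq ι]
    {S : Matrix ι ι ℝ} (hS : S.PosSemidef) (i : ι) :
    ∫ x, |x i| ∂multivariateGaussian 0 S = √(S i i) * ∫ y, |y| ∂gaussianReal 0 1 := by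
  have hp := measurePreserving_eval_multivariateGaussian (μ := 0) hS (i := i)
  have hscale : (gaussianReal 0 1).map (√(S i i) * ·) = gaussianReal 0 (S i i).toNNReal := by
    rw [gaussianReal_map_const_mul, mul_zero, mul_one]
    congr 1
    ext
    simp [Real.sq_sqrt hS.diag_nonneg, hS.diag_nonneg]
  calc ∫ x, |x i| ∂multivariateGaussian 0 S
      = ∫ y, |y| ∂gaussianReal 0 (S i i).toNNReal := by
        rw [PiLp.zero_apply] at hp
        rw [← hp.map_eq, integral_map hp.measurable.aemeasurable
          continuous_abs.aestronglyMeasurable]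
    _ = √(S i i) * ∫ y, |y| ∂gaussianReal 0 1 := by
        rw [← hscale, integral_map (by fun_prop) continuous_abs.aestronglyMeasurable,
          ← integral_const_mul]
        simp [abs_mul, abs_of_nonneg (Real.sqrt_nonneg _)]

theorem integral_abs_gaussianReal_pos : 0 < ∫ y, |y| ∂gaussianReal 0 1 := by
  have hint : Integrable (fun y : ℝ => |y|) (gaussianReal 0 1) :=
    (IsGaussian.integrable_id (μ := gaussianReal 0 1)).abs
  rw [integral_pos_iff_support_of_nonneg (fun y => abs_nonneg y) hint]
  have : NullSingletonClass (gaussianReal 0 1) := nullSingletonClass_gaussianReal one_ne_zero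
  have hsupp : support (fun y : ℝ => |y|) = {0}ᶜ := by ext; simp
  rw [hsupp, prob_compl_eq_one_sub (measurableSet_singleton 0), measure_singleton]
  simp

theorem sqrt_mul_le_gaussianMax {G : Type*} [Group G] [DecidableEq G] {f : G → ℝ}
    (hf : IsCNDFunction f) {T : Finset G} (h1 : 1 ∈ T) {t : G} (ht : t ∈ T) :
    √(f t) * (∫ y, |y| ∂gaussianReal 0 1) / 2 ≤ gaussianMax f T := by
  have : Nonempty T := ⟨⟨1, h1⟩⟩
  have hS := hf.posSemidef_schoenbergMatrix T
  have hi := integrable_eval_multivariateGaussian 0 (schoenbergMatrix f T)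
  have hdiag : ∀ s : T, schoenbergMatrix f T s s = f s := fun s => by
    simp [schoenbergMatrix, hf.apply_one]
  have habs : ∀ s : T, ∫ x, |x s| ∂multivariateGaussian 0 (schoenbergMatrix f T) =
      √(f s) * ∫ y, |y| ∂gaussianReal 0 1 := fun s => by
    rw [integral_abs_eval_multivariateGaussian_zero hS, hdiag]
  have hval : ∫ x, (x ⟨1, h1⟩ + x ⟨t, ht⟩ + (|x ⟨t, ht⟩| - |x ⟨1, h1⟩|)) / 2
      ∂multivariateGaussian 0 (schoenbergMatrix f T) =
      √(f t) * (∫ y, |y| ∂gaussianReal 0 1) / 2 := by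
    rw [integral_div, integral_add (by exact (hi _).add (hi _))
      (by exact (hi _).abs.sub (hi _).abs),
      integral_add (hi _) (hi _), integral_sub (hi _).abs (hi _).abs, habs, habs,
      integral_eval_multivariateGaussian_zero, integral_eval_multivariateGaussian_zero]
    simp [hf.apply_one]
  rw [← hval]
  refine integral_mono
    ((((hi _).add (hi _)).add ((hi _).abs.sub (hi _).abs)).div_const 2)
    (integrable_iSup_multivariateGaussian 0 _ id) fun x => ?_
  have hle : ∀ s : T, x s ≤ ⨆ s, x s := le_ciSup (Set.finite_range _).bddAbove
  have h2 := hle ⟨1, h1⟩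
  have h3 := hle ⟨t, ht⟩
  dsimp only
  rcases abs_cases (x ⟨1, h1⟩) with h | h <;> rcases abs_cases (x ⟨t, ht⟩) with h' | h' <;>
    linarith

theorem gaussianMax_nonneg {G : Type*} [Group G] [DecidableEq G] {f : G → ℝ}
    (hf : IsCNDFunction f) {T : Finset G} (h1 : 1 ∈ T) : 0 ≤ gaussianMax f T := by
  simpa [hf.apply_one] using sqrt_mul_le_gaussianMax hf h1 h1

theorem isCNDKernel_gaussianMax {G X : Type*} [Group G] [DecidableEq G] {f : G → ℝ}
    (hf : IsCNDFunction f) {T : X → X → Finset G} (hT : ∀ x y, (T x y).Nonempty)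
    (hsymm : ∀ x y, T x y = T y x) (hsub : ∀ x y z, T x z ⊆ T x y ∪ T y z)
    (hdiag : ∀ x, ∃ g, T x x = {g}) : IsCNDKernel fun x y => gaussianMax f (T x y) := by
  refine ⟨fun x y => congrArg _ (hsymm x y), fun x => ?_, fun n x c hc => ?_⟩
  · obtain ⟨g, hg⟩ := hdiag x
    simp only [hg, gaussianMax_singleton]
  · have hne : ∀ x y, Nonempty (T x y) := fun x y => (hT x y).to_subtype
    let U : Finset G := Finset.univ.biUnion fun p : Fin n × Fin n => T (x p.1) (x p.2)
    have hU : ∀ i j, T (x i) (x j) ⊆ U := fun i j =>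
      Finset.subset_biUnion_of_mem (fun p : Fin n × Fin n => T (x p.1) (x p.2))
        (Finset.mem_univ (i, j))
    let δ : EuclideanSpace ℝ U → Fin n → Fin n → ℝ :=
      fun ω i j => ⨆ t : T (x i) (x j), ω ⟨t, hU i j t.2⟩
    have hδ : ∀ i j, Integrable (fun ω => δ ω i j)
        (multivariateGaussian 0 (schoenbergMatrix f U)) := fun i j =>
      integrable_iSup_multivariateGaussian _ _ _
    have key : ∑ i, ∑ j, c i * c j * gaussianMax f (T (x i) (x j)) =
        ∫ ω, ∑ i, ∑ j, c i * c j * δ ω i j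
          ∂multivariateGaussian 0 (schoenbergMatrix f U) := by
      rw [integral_finsetSum _ fun i _ => integrable_finsetSum _ fun j _ =>
        (hδ i j).const_mul _]
      refine Finset.sum_congr rfl fun i _ => ?_
      rw [integral_finsetSum _ fun j _ => (hδ i j).const_mul _]
      refine Finset.sum_congr rfl fun j _ => ?_
      rw [integral_const_mul, integral_iSup_eq_gaussianMax hf (hU i j) (hT _ _)]
    rw [key]
    refine integral_nonpos fun ω => sum_nonpos_of_le_max (δ ω) (fun i j => ?_)
      (fun i j k => ciSup_le fun t => ?_) c hc
    · have hle : ∀ i j, δ ω i j ≤ δ ω j i := fun i j => ciSup_le fun t =>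
        le_ciSup (f := fun t : T (x j) (x i) => ω ⟨t, hU j i t.2⟩)
          (Set.finite_range _).bddAbove ⟨t, hsymm (x i) (x j) ▸ t.2⟩
      exact le_antisymm (hle i j) (hle j i)
    · rcases Finset.mem_union.1 (hsub (x i) (x j) (x k) t.2) with h | h
      · exact le_max_of_le_left (le_ciSup (f := fun t : T (x i) (x j) => ω ⟨t, hU i j t.2⟩)
          (Set.finite_range _).bddAbove ⟨t, h⟩)
      · exact le_max_of_le_right (le_ciSup (f := fun t : T (x j) (x k) => ω ⟨t, hU j k t.2⟩)
          (Set.finite_range _).bddAbove ⟨t, h⟩)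

/-- The construction of a proper conditionally negative definite function on `W ⋊ G`, for a gauge
whose value at `1` is empty. -/
theorem exists_proper_isCNDFunction_semidirectProduct {G W : Type*} [Group G] [Group W]
    [DecidableEq G] [MulDistribMulAction G W] (ψ : W → Finset G) (hone : ψ 1 = ∅)
    (hinv : ∀ w : W, ψ w⁻¹ = ψ w) (hsub : ∀ w w' : W, ψ (w * w') ⊆ ψ w ∪ ψ w')
    (hequiv : ∀ (g : G) (w : W), ψ (g • w) = (ψ w).image (g * ·))
    {u : W → ℝ} (hu : IsCNDFunction u) (huG : ∀ (g : G) (w : W), u (g • w) = u w)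
    (huprop : ∀ (F : Finset G) (R : ℝ), {w : W | ψ w ⊆ F ∧ u w ≤ R}.Finite)
    {f : G → ℝ} (hf : IsCNDFunction f) (hfp : IsProperFunction f) :
    ∃ F : (W ⋊[MulDistribMulAction.toMulAut G W] G) → ℝ,
      IsCNDFunction F ∧ IsProperFunction F := by
  let T : (W ⋊[MulDistribMulAction.toMulAut G W] G) →
      (W ⋊[MulDistribMulAction.toMulAut G W] G) → Finset G :=
    fun x y => {x.right, y.right} ∪ ψ (x.left⁻¹ * y.left)
  have hleft : ∀ x y : W ⋊[MulDistribMulAction.toMulAut G W] G,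
      (x⁻¹ * y).left = x.right⁻¹ • (x.left⁻¹ * y.left) := fun x y => by
    simp [smul_mul']
  have hTmul : ∀ x y, T x y = (T 1 (x⁻¹ * y)).image (x.right * ·) := fun x y => by
    simp only [T, hleft, hequiv, Finset.image_union, SemidirectProduct.one_left,
      SemidirectProduct.one_right, inv_one, one_mul, Finset.image_image]
    congr 1
    · simp [Finset.image_insert]
    · simp [Function.comp_def]
  have hTne : ∀ x y, (T x y).Nonempty := fun x y => ⟨x.right, by simp [T]⟩
  have hTsymm : ∀ x y, T x y = T y x := fun x y => by
    simp only [T]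
    rw [Finset.pair_comm, ← hinv, mul_inv_rev, inv_inv]
  have hTsub : ∀ x y z, T x z ⊆ T x y ∪ T y z := fun x y z g hg => by
    have h := hsub (x.left⁻¹ * y.left) (y.left⁻¹ * z.left)
    rw [show x.left⁻¹ * y.left * (y.left⁻¹ * z.left) = x.left⁻¹ * z.left by group] at h
    have h' := @h g
    simp only [T, Finset.mem_union, Finset.mem_insert, Finset.mem_singleton] at hg h' ⊢
    tauto
  have hTdiag : ∀ x, ∃ g, T x x = {g} := fun x => ⟨x.right, by simp [T, hone]⟩
  have hT1 : ∀ x, 1 ∈ T 1 x := fun x => by simp [T]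
  refine ⟨fun x => gaussianMax f (T 1 x) + u x.left, ?_, fun R => ?_⟩
  · have h := (isCNDKernel_gaussianMax hf hTne hTsymm hTsub hTdiag).add
      (IsCNDKernel.comp hu fun x : W ⋊[MulDistribMulAction.toMulAut G W] G => x.left)
    unfold IsCNDFunction
    convert h using 3 with x y
    simp only [hTmul x y, gaussianMax_image_mul_left hf _ (hTne _ _), hleft, huG]
  · set c := ∫ y, |y| ∂gaussianReal 0 1
    have hc : 0 < c := integral_abs_gaussianReal_pos
    let B := (hfp ((2 * R / c) ^ 2)).toFinset
    refine Set.Finite.subset (((huprop B R).prod B.finite_toSet).preimage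
      (f := fun x : W ⋊[MulDistribMulAction.toMulAut G W] G => (x.left, x.right))
      fun x _ y _ hxy => SemidirectProduct.ext (congrArg Prod.fst hxy) (congrArg Prod.snd hxy))
      fun x hx => ?_
    have hx' : gaussianMax f (T 1 x) + u x.left ≤ R := hx
    have hball : ∀ t ∈ T 1 x, t ∈ B := fun t ht => by
      have h := sqrt_mul_le_gaussianMax hf (hT1 x) ht
      have hs : √(f t) ≤ 2 * R / c := by
        rw [le_div_iff₀ hc]
        linarith [hu.nonneg x.left]
      simpa [B] using (Real.sqrt_le_left ((Real.sqrt_nonneg _).trans hs)).1 hs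
    refine ⟨⟨fun t ht => hball t ?_, ?_⟩, hball _ ?_⟩
    · simpa [T] using Or.inr (Or.inr ht)
    · linarith [gaussianMax_nonneg hf (hT1 x)]
    · simp [T]

open scoped Classical in
/-- **Theorem.** Let `G` act by automorphisms on `W`, let `ψ` be a `W`-invariant,
`G`-equivariant gauge on `W` with values in finite subsets of `G`, and suppose there is a
`G`-invariant conditionally negative definite function `u` on `W` whose restriction to each
`W_F = {w | ψ(w) ⊆ F}` (`F ⊆ G` finite) is proper. Then `W ⋊ G` admits a proper
conditionally negative definite function (is Haagerup) if and only if `G` does. -/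
theorem semidirect_haagerup_iff {G W : Type*} [Group G] [Group W]
    [Countable G] [Countable W] [MulDistribMulAction G W]
    (ψ : W → Finset G)
    (hinv : ∀ w : W, ψ w⁻¹ = ψ w)
    (hsub : ∀ w w' : W, ψ (w * w') ⊆ ψ w ∪ ψ w')
    (hequiv : ∀ (g : G) (w : W), (ψ (g • w) : Set G) = (fun x => g * x) '' (ψ w : Set G))
    (u : W → ℝ) (hu : IsCNDFunction u)
    (huG : ∀ (g : G) (w : W), u (g • w) = u w)
    (huprop : ∀ (F : Finset G) (R : ℝ),
      {w : W | (ψ w : Set G) ⊆ (F : Set G) ∧ u w ≤ R}.Finite) :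
    (∃ f : (W ⋊[MulDistribMulAction.toMulAut G W] G) → ℝ,
        IsCNDFunction f ∧ IsProperFunction f) ↔
    (∃ f : G → ℝ, IsCNDFunction f ∧ IsProperFunction f) := by
  refine ⟨fun ⟨f, hf, hfp⟩ => ⟨f ∘ SemidirectProduct.inr, hf.comp_hom _, fun R =>
    (hfp R).preimage SemidirectProduct.inr_injective.injOn⟩, fun ⟨f, hf, hfp⟩ => ?_⟩
  have hequiv' : ∀ (g : G) (w : W), ψ (g • w) = (ψ w).image (g * ·) := fun g w => by
    rw [← Finset.coe_inj, hequiv, Finset.coe_image]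
  refine exists_proper_isCNDFunction_semidirectProduct (fun w => ψ w \ ψ 1) (by simp)
    (fun w => by simp only [hinv]) (fun w w' => ?_) (fun g w => ?_) hu huG (fun F R => ?_) hf hfp
  · rw [← Finset.union_sdiff_distrib]
    exact Finset.sdiff_subset_sdiff (hsub w w') subset_rfl
  · rw [Finset.image_sdiff _ _ (mul_right_injective g), ← hequiv', ← hequiv', smul_one]
  · refine (huprop (F ∪ ψ 1) R).subset fun w hw => ⟨?_, hw.2⟩
    have h : ψ w ⊆ F ∪ ψ 1 := by
      rw [Finset.union_comm]
      exact sdiff_le_iff.1 (Finset.coe_subset.1 hw.1)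
    exact_mod_cast h
end

section
/- Let G be a countable group. The following are equivalent: (i) G admits a coarse embedding into a real Hilbert space; (ii) there exists a conditionally negative definite kernel κ on G which is G-uniform (for all h₁,h₂ ∈ G, sup_{g∈G} κ(gh₁,gh₂) < ∞) and effectively proper (for every R ≥ 0 the set {x⁻¹y : x,y ∈ G, κ(x,y) ≤ R} is finite). -/
open MeasureTheory Function Set
open scoped ENNReal
/-- The group `Γ` admits a coarse embedding into a real Hilbert space. -/
def AdmitsCoarseEmb (Γ : Type*) [Group Γ] : Prop :=
  ∃ (E : Type) (_ : NormedAddCommGroup E) (_ : InnerProductSpace ℝ E) (_ : CompleteSpace E)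
    (f : Γ → E),
      (∀ F : Set Γ, F.Finite → ∃ M : ℝ, ∀ x y : Γ, x⁻¹ * y ∈ F → ‖f x - f y‖ ≤ M) ∧
      ∀ R : ℝ, {d : Γ | ∃ x y : Γ, x⁻¹ * y = d ∧ ‖f x - f y‖ ≤ R}.Finite

/-- The square of the distance in an inner product space is conditionally negative definite. -/
theorem isCNDKernel_norm_sub_sq {X E : Type*} [NormedAddCommGroup E] [InnerProductSpace ℝ E]
    (f : X → E) : IsCNDKernel fun x y => ‖f x - f y‖ ^ 2 := by
  refine ⟨fun x y => by simp only [norm_sub_rev], fun x => by simp, fun n x c hc => ?_⟩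
  have h := inner_sum_smul_sum_smul_of_sum_eq_zero (fun i => f (x i)) hc
    (fun i => f (x i)) hc
  have h0 := real_inner_self_nonneg (x := ∑ i, c i • f (x i))
  simp only [← sq] at h
  linarith

namespace IsCNDKernel

variable {X Y : Type*} {κ : X → X → ℝ}

theorem comp_s13 (hκ : IsCNDKernel κ) (s : Y → X) : IsCNDKernel fun x y => κ (s x) (s y) :=
  ⟨fun _ _ => hκ.1 _ _, fun _ => hκ.2.1 _, fun n x c hc => hκ.2.2 n (s ∘ x) c hc⟩

/-- The Gromov product of a conditionally negative definite kernel is positive semidefinite. -/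
theorem gromovProduct_sum_nonneg (hκ : IsCNDKernel κ) (o : X) {n : ℕ} (x : Fin n → X)
    (v : Fin n → ℝ) :
    0 ≤ ∑ i, ∑ j, v i * v j * ((κ (x i) o + κ (x j) o - κ (x i) (x j)) / 2) := by
  obtain ⟨hsymm, hdiag, hneg⟩ := hκ
  have h := hneg (n + 1) (Fin.cons o x) (Fin.cons (-∑ i, v i) v) (by simp [Fin.sum_univ_succ])
  simp only [Fin.sum_univ_succ, Fin.cons_zero, Fin.cons_succ, hdiag, hsymm o,
    Finset.sum_add_distrib] at h
  have hl (S : ℝ) : ∑ i, -S * v i * κ (x i) o = -(S * ∑ i, v i * κ (x i) o) := by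
    rw [Finset.mul_sum, ← Finset.sum_neg_distrib]
    exact Finset.sum_congr rfl fun i _ => by ring
  have hr (S : ℝ) : ∑ i, v i * -S * κ (x i) o = -(S * ∑ i, v i * κ (x i) o) := by
    rw [Finset.mul_sum, ← Finset.sum_neg_distrib]
    exact Finset.sum_congr rfl fun i _ => by ring
  have hsum : ∑ i, ∑ j, v i * v j * ((κ (x i) o + κ (x j) o - κ (x i) (x j)) / 2) =
      ((∑ i, v i * κ (x i) o) * (∑ j, v j) + (∑ j, v j) * (∑ i, v i * κ (x i) o)
        - ∑ i, ∑ j, v i * v j * κ (x i) (x j)) / 2 := by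
    rw [Finset.sum_mul_sum, Finset.sum_mul_sum]
    simp only [← Finset.sum_add_distrib, ← Finset.sum_sub_distrib, Finset.sum_div]
    exact Finset.sum_congr rfl fun i _ => Finset.sum_congr rfl fun j _ => by ring
  rw [hl, hr] at h
  rw [hsum]
  linarith

/-- A conditionally negative definite kernel is the square of a Hilbert space distance. -/
theorem exists_norm_sub_sq_eq {X : Type} {κ : X → X → ℝ} (hκ : IsCNDKernel κ) :
    ∃ (E : Type) (_ : NormedAddCommGroup E) (_ : InnerProductSpace ℝ E) (_ : CompleteSpace E)
      (f : X → E), ∀ x y, ‖f x - f y‖ ^ 2 = κ x y := by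
  rcases isEmpty_or_nonempty X with _ | ⟨⟨o⟩⟩
  · exact ⟨ℝ, inferInstance, inferInstance, inferInstance, fun _ => 0, fun x => isEmptyElim x⟩
  let K : Matrix X X (ℝ →L[ℝ] ℝ) := .of fun x y =>
    ((κ x o + κ y o - κ x y) / 2) • ContinuousLinearMap.id ℝ ℝ
  have hK : K.PosSemidef := by
    refine ((RKHS.posSemidef_tfae (𝕜 := ℝ) (K := K)).out 0 2 :).2 ⟨?_, fun v => ?_⟩
    · ext x y
      simp [K, hκ.1 x y, add_comm, ← ContinuousLinearMap.one_def]
    · let e := v.support.equivFin.symm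
      have hsum (F : X → ℝ) : ∑ i, F (e i) = ∑ a ∈ v.support, F a := by
        rw [e.sum_comp (fun a : v.support => F a), Finset.sum_coe_sort v.support F]
      have h := hκ.gromovProduct_sum_nonneg o (fun i => (e i : X)) (fun i => v (e i))
      simp_rw [fun a : X => hsum fun b => v a * v b * ((κ a o + κ b o - κ a b) / 2)] at h
      rw [hsum fun a => ∑ b ∈ v.support, v a * v b * ((κ a o + κ b o - κ a b) / 2)] at h
      refine h.trans_eq ?_
      simp only [Finsupp.sum, RCLike.re_to_real]
      refine Finset.sum_congr rfl fun a _ => Finset.sum_congr rfl fun b _ => ?_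
      simp [K, hκ.1 b a]
      ring
  have : Fact K.PosSemidef := ⟨hK⟩
  refine ⟨RKHS.OfKernel K, inferInstance, inferInstance, inferInstance,
    fun x => RKHS.kerFun (RKHS.OfKernel K) x 1, fun x y => ?_⟩
  have hin (a b : X) : inner ℝ (RKHS.kerFun (RKHS.OfKernel K) a 1)
      (RKHS.kerFun (RKHS.OfKernel K) b 1) = (κ a o + κ b o - κ a b) / 2 := by
    rw [← RKHS.kernel_inner, RKHS.OfKernel.kernel_ofKernel]
    simp [K, hκ.1 b a, add_comm]
  rw [norm_sub_sq_real, ← real_inner_self_eq_norm_sq, ← real_inner_self_eq_norm_sq, hin, hin, hin,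
    hκ.2.1, hκ.2.1]
  ring

end IsCNDKernel

/-- **Proposition.** A countable group `G` admits a coarse embedding into a real Hilbert
space iff it carries a conditionally negative definite kernel which is `G`-uniform and
effectively proper. -/
theorem coarse_embedding_iff_kernel (G : Type*) [Group G] [Countable G] :
    AdmitsCoarseEmb G ↔
      ∃ κ : G → G → ℝ, IsCNDKernel κ ∧
        (∀ h₁ h₂ : G, ∃ M : ℝ, ∀ g : G, κ (g * h₁) (g * h₂) ≤ M) ∧
        (∀ R : ℝ, {d : G | ∃ x y : G, x⁻¹ * y = d ∧ κ x y ≤ R}.Finite) := by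
  constructor
  · rintro ⟨E, _, _, _, f, hbdd, hfin⟩
    refine ⟨fun x y => ‖f x - f y‖ ^ 2, isCNDKernel_norm_sub_sq f, fun h₁ h₂ => ?_, fun R => ?_⟩
    · obtain ⟨M, hM⟩ := hbdd {h₁⁻¹ * h₂} (Set.finite_singleton _)
      exact ⟨M ^ 2, fun g => pow_le_pow_left₀ (norm_nonneg _) (hM _ _ (by simp [mul_assoc])) 2⟩
    · refine (hfin (√R)).subset ?_
      rintro d ⟨x, y, hd, hR⟩
      exact ⟨x, y, hd, Real.le_sqrt_of_sq_le hR⟩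
  · rintro ⟨κ, hκ, hunif, hfin⟩
    obtain ⟨s, hs⟩ := exists_surjective_nat G
    obtain ⟨E, i₁, i₂, i₃, f, hf⟩ := (hκ.comp_s13 s).exists_norm_sub_sq_eq
    have hdist (x y : G) : ‖f (surjInv hs x) - f (surjInv hs y)‖ ^ 2 = κ x y := by
      rw [hf, surjInv_eq hs, surjInv_eq hs]
    refine ⟨E, i₁, i₂, i₃, f ∘ surjInv hs, fun F hF => ?_, fun R => ?_⟩
    · choose M hM using hunif 1
      obtain ⟨B, hB⟩ := (hF.image M).bddAbove
      refine ⟨√B, fun x y hxy => Real.le_sqrt_of_sq_le ?_⟩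
      have h := hM (x⁻¹ * y) x
      rw [mul_one, mul_inv_cancel_left] at h
      exact (hdist x y).trans_le (h.trans (hB (Set.mem_image_of_mem M hxy)))
    · refine (hfin (R ^ 2)).subset ?_
      rintro d ⟨x, y, hd, hR⟩
      exact ⟨x, y, hd, (hdist x y).symm.trans_le (pow_le_pow_left₀ (norm_nonneg _) hR 2)⟩
end

section
/- Let H, G be countable groups, X a nonempty countable G-set, W = H^{(X)}, and let p_x : W → H denote the projection w ↦ w(x). For a subgroup K of W, the following are equivalent: (i) (W, K) has relative Property T; (ii) (H ≀_X G, K) has relative Property T; (iii) there exists a finite subset C ⊆ X such that K ⊆ H^C := {w ∈ W : Supp(w) ⊆ C} and (H, p_x(K)) has relative Property T for every x ∈ C. -/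
open MeasureTheory Function Set
open scoped ENNReal
/-- Relative Property (T) for a pair `(Γ, S)`: every conditionally negative definite
function on `Γ` is bounded on `S`. -/
def RelPropT (Γ : Type*) [Group Γ] (S : Set Γ) : Prop :=
  ∀ ψ : Γ → ℝ, IsCNDFunction ψ → ∃ M : ℝ, ∀ s ∈ S, ψ s ≤ M
/-- The group of finitely supported functions `X → H` under pointwise multiplication. -/
def FinSuppSubgroup (H : Type*) [Group H] (X : Type*) : Subgroup (X → H) where
  carrier := {w | (Function.mulSupport w).Finite}
  one_mem' := by simpa [Function.mulSupport_one] using Set.finite_empty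
  mul_mem' := by
    intro a b ha hb
    exact (ha.union hb).subset (Function.mulSupport_mul a b)
  inv_mem' := by
    intro a ha
    simpa [Function.mulSupport_inv] using ha

/-- The shift action of `G` on finitely supported functions `X → H`, for a `G`-set `X`:
`(g·w)(x) = w(g⁻¹ • x)`. -/
def wreathShift (H : Type*) [Group H] (X : Type*) (G : Type*) [Group G] [MulAction G X] :
    G →* MulAut (FinSuppSubgroup H X) where
  toFun g :=
    { toFun := fun w => ⟨fun x => (w : X → H) (g⁻¹ • x), by
        refine (w.2.image (fun x => g • x)).subset ?_
        intro x hx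
        exact ⟨g⁻¹ • x, hx, by simp⟩⟩
      invFun := fun w => ⟨fun x => (w : X → H) (g • x), by
        refine (w.2.image (fun x => g⁻¹ • x)).subset ?_
        intro x hx
        exact ⟨g • x, hx, by simp⟩⟩
      left_inv := by intro w; apply Subtype.ext; funext x; simp
      right_inv := by intro w; apply Subtype.ext; funext x; simp
      map_mul' := by intro a b; rfl }
  map_one' := by
    apply MulEquiv.ext; intro w; apply Subtype.ext; funext x; simp
  map_mul' := by
    intro a b
    apply MulEquiv.ext; intro w; apply Subtype.ext; funext x
    simp [mul_smul]

/-- The permutational wreath product `H ≀_X G = H^{(X)} ⋊ G`. -/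
abbrev PermWreath (H : Type*) [Group H] (X : Type*) (G : Type*) [Group G] [MulAction G X] :=
  FinSuppSubgroup H X ⋊[wreathShift H X G] G

/-- The standard wreath product `H ≀ G = H^{(G)} ⋊ G`. -/
abbrev StandardWreath (H : Type*) [Group H] (G : Type*) [Group G] := PermWreath H G G

namespace IsCNDFunction

variable {Γ Γ' : Type*} [Group Γ] [Group Γ'] {ψ : Γ → ℝ}

theorem comp_hom_s16 (hψ : IsCNDFunction ψ) (f : Γ' →* Γ) : IsCNDFunction (ψ ∘ f) := by
  obtain ⟨h1, h2, h3⟩ := hψ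
  refine ⟨fun x y => ?_, fun x => ?_, fun n x c hc => ?_⟩
  · simpa using h1 (f x) (f y)
  · simpa using h2 (f x)
  · simpa using h3 n (f ∘ x) c hc

theorem map_one (hψ : IsCNDFunction ψ) : ψ 1 = 0 := by
  simpa using hψ.2.1 1

theorem map_inv (hψ : IsCNDFunction ψ) (g : Γ) : ψ g⁻¹ = ψ g := by
  simpa using hψ.1 g 1

theorem nonneg_s16 (hψ : IsCNDFunction ψ) (g : Γ) : 0 ≤ ψ g := by
  have h := hψ.2.2 2 ![1, g] ![1, -1] (by simp)
  simp only [Fin.sum_univ_two, Matrix.cons_val_zero, Matrix.cons_val_one, inv_one, one_mul,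
    mul_one, inv_mul_cancel, hψ.map_one, hψ.map_inv] at h
  linarith

theorem map_mul_le (hψ : IsCNDFunction ψ) (a b : Γ) : ψ (a * b) ≤ 2 * ψ a + 2 * ψ b := by
  have h := hψ.2.2 3 ![a, 1, a * b] ![-2, 1, 1] (by simp [Fin.sum_univ_three]; norm_num)
  have hb : ψ ((a * b)⁻¹ * a) = ψ b := by
    rw [← hψ.map_inv]; congr 1; group
  simp [Fin.sum_univ_three, hψ.map_one, hψ.map_inv, hb, -mul_inv_rev] at h
  linarith

end IsCNDFunction

theorem RelPropT.image_hom {Γ Γ' : Type*} [Group Γ] [Group Γ'] {S : Set Γ}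
    (h : RelPropT Γ S) (f : Γ →* Γ') : RelPropT Γ' (f '' S) := by
  intro ψ hψ
  obtain ⟨M, hM⟩ := h _ (hψ.comp_hom_s16 f)
  exact ⟨M, by rintro _ ⟨s, hs, rfl⟩; exact hM s hs⟩

open scoped Classical in
theorem isCNDFunction_indicator_ne_one (H : Type*) [Group H] :
    IsCNDFunction (fun h : H => if h = 1 then (0 : ℝ) else 1) := by
  refine ⟨fun x y => ?_, fun x => by simp, fun n x c hc => ?_⟩
  · simp only [inv_mul_eq_one, eq_comm]
  · have key : ∑ i, ∑ j, c i * c j * (if (x i)⁻¹ * x j = 1 then (0 : ℝ) else 1) =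
        (∑ i, c i) * (∑ j, c j) -
          ∑ h ∈ Finset.univ.image x, (∑ i, if x i = h then c i else 0) ^ 2 := by
      have h2 : ∑ h ∈ Finset.univ.image x, (∑ i, if x i = h then c i else 0) ^ 2 =
          ∑ i, ∑ j, if x i = x j then c i * c j else 0 := by
        simp only [sq, Finset.sum_mul_sum]
        rw [Finset.sum_comm]
        refine Finset.sum_congr rfl fun i _ => ?_
        rw [Finset.sum_comm]
        refine Finset.sum_congr rfl fun j _ => ?_
        rw [Finset.sum_eq_single_of_mem (x i) (Finset.mem_image_of_mem x (Finset.mem_univ i))]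
        · simp [eq_comm]
        · intro b _ hb
          simp [hb.symm]
      rw [h2, Finset.sum_mul_sum, ← Finset.sum_sub_distrib]
      refine Finset.sum_congr rfl fun i _ => ?_
      rw [← Finset.sum_sub_distrib]
      refine Finset.sum_congr rfl fun j _ => ?_
      simp only [inv_mul_eq_one]
      split_ifs <;> ring
    rw [key, hc]
    have := Finset.sum_nonneg fun h (_ : h ∈ Finset.univ.image x) =>
      sq_nonneg (∑ i, if x i = h then c i else 0)
    linarith

section PermWreath

variable {H G X : Type*} [Group H] [Group G] [MulAction G X]

theorem PermWreath.inv_mul_left_apply (p q : PermWreath H X G) (x : X) :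
    ((p⁻¹ * q).left : X → H) x =
      ((p.left : X → H) (p.right • x))⁻¹ * (q.left : X → H) (p.right • x) := by
  simp [SemidirectProduct.mul_left, SemidirectProduct.inv_left, wreathShift]

theorem PermWreath.isCNDFunction_finsum {ψ : H → ℝ} (hψ : IsCNDFunction ψ) :
    IsCNDFunction (fun p : PermWreath H X G => ∑ᶠ x, ψ ((p.left : X → H) x)) := by
  have key (p q : PermWreath H X G) : ∑ᶠ x, ψ (((p⁻¹ * q).left : X → H) x) =
      ∑ᶠ x, ψ (((p.left : X → H) x)⁻¹ * (q.left : X → H) x) := by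
    simp only [PermWreath.inv_mul_left_apply]
    exact finsum_comp_equiv (MulAction.toPerm p.right)
      (f := fun x => ψ (((p.left : X → H) x)⁻¹ * (q.left : X → H) x))
  refine ⟨fun p q => ?_, fun p => ?_, fun n p c hc => ?_⟩
  · simp only [key]
    exact finsum_congr fun x => hψ.1 _ _
  · simp [hψ.map_one]
  · simp only [key]
    have hfin : (⋃ i, mulSupport ((p i).left : X → H)).Finite :=
      Set.finite_iUnion fun i => (p i).left.2
    have hsum (i j) : ∑ᶠ x, ψ ((((p i).left : X → H) x)⁻¹ * ((p j).left : X → H) x) =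
        ∑ x ∈ hfin.toFinset, ψ ((((p i).left : X → H) x)⁻¹ * ((p j).left : X → H) x) := by
      refine finsum_eq_sum_of_support_subset _ fun x hx => ?_
      by_contra hx'
      simp only [Finite.coe_toFinset, mem_iUnion, mem_mulSupport, not_exists, not_not] at hx'
      simp [hx', hψ.map_one] at hx
    simp only [hsum, Finset.mul_sum]
    have hswap : ∑ i, ∑ j, ∑ x ∈ hfin.toFinset,
        c i * c j * ψ ((((p i).left : X → H) x)⁻¹ * ((p j).left : X → H) x) =
        ∑ x ∈ hfin.toFinset, ∑ i, ∑ j,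
          c i * c j * ψ ((((p i).left : X → H) x)⁻¹ * ((p j).left : X → H) x) := by
      symm
      rw [Finset.sum_comm]
      exact Finset.sum_congr rfl fun i _ => Finset.sum_comm
    rw [hswap]
    exact Finset.sum_nonpos fun x _ => hψ.2.2 n (fun i => ((p i).left : X → H) x) c hc

end PermWreath

namespace FinSuppSubgroup

variable {H X : Type*} [Group H]

open scoped Classical in
/-- The inclusion of `H` as the factor of `H^{(X)}` at `x`. -/
noncomputable def mulSingle (x : X) : H →* FinSuppSubgroup H X :=
  (MonoidHom.mulSingle (fun _ : X => H) x).codRestrict _ fun _ =>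
    (Set.finite_singleton x).subset (Pi.mulSupport_mulSingle_subset)

theorem mulSingle_apply_same (x : X) (h : H) : (mulSingle x h : X → H) x = h := by
  classical exact Pi.mulSingle_eq_same (M := fun _ => H) x h

theorem mulSingle_apply_of_ne {x y : X} (hxy : y ≠ x) (h : H) :
    (mulSingle x h : X → H) y = 1 := by
  classical exact Pi.mulSingle_eq_of_ne (M := fun _ => H) hxy h

theorem bddAbove_of_forall_coordinate {ψ : FinSuppSubgroup H X → ℝ} (hψ : IsCNDFunction ψ)
    (S : X → Set H) (C : Finset X) (hS : ∀ x ∈ C, RelPropT H (S x)) :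
    ∃ M : ℝ, ∀ w : FinSuppSubgroup H X, mulSupport (w : X → H) ⊆ C →
      (∀ x ∈ C, (w : X → H) x ∈ S x) → ψ w ≤ M := by
  classical
  induction C using Finset.induction_on with
  | empty =>
    refine ⟨0, fun w hw _ => ?_⟩
    have : w = 1 := by
      apply Subtype.ext
      simpa [mulSupport_eq_empty_iff] using hw
    rw [this, hψ.map_one]
  | insert a C ha ih =>
    obtain ⟨M, hM⟩ := ih fun x hx => hS x (Finset.mem_insert_of_mem hx)
    obtain ⟨N, hN⟩ := hS a (Finset.mem_insert_self a C) _ (hψ.comp_hom_s16 (mulSingle a))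
    refine ⟨2 * N + 2 * M, fun w hw hwS => ?_⟩
    set s := mulSingle a ((w : X → H) a) with hs
    have hrest {y : X} (hy : y ≠ a) : ((s⁻¹ * w : FinSuppSubgroup H X) : X → H) y = w.1 y := by
      simp [hs, mulSingle_apply_of_ne hy]
    have h1 : ψ s ≤ N := hN _ (hwS a (Finset.mem_insert_self a C))
    have h2 : ψ (s⁻¹ * w) ≤ M := by
      refine hM _ (fun y hy => ?_) fun y hy => ?_
      · have hya : y ≠ a := by
          rintro rfl
          simp [hs, mulSingle_apply_same] at hy
        rw [mem_mulSupport, hrest hya] at hy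
        exact (Finset.mem_insert.1 (hw hy)).resolve_left hya
      · rw [hrest (ne_of_mem_of_not_mem hy ha)]
        exact hwS y (Finset.mem_insert_of_mem hy)
    have := hψ.map_mul_le s (s⁻¹ * w)
    rw [mul_inv_cancel_left] at this
    linarith

open scoped Classical in
theorem exists_list_two_mul_countP_le (K : Subgroup (FinSuppSubgroup H X)) (D : Finset X)
    (hD : ∀ x ∈ D, ∃ w ∈ K, (w : X → H) x ≠ 1) :
    ∃ l : List (FinSuppSubgroup H X), l ≠ [] ∧ (∀ w ∈ l, w ∈ K) ∧
      ∀ x ∈ D, 2 * l.countP (fun w : FinSuppSubgroup H X => (w : X → H) x = 1) ≤ l.length := by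
  induction D using Finset.induction_on with
  | empty => exact ⟨[1], by simp, by simp [K.one_mem], by simp⟩
  | insert a D ha ih =>
    obtain ⟨l, hl, hlK, hlD⟩ := ih fun x hx => hD x (Finset.mem_insert_of_mem hx)
    obtain ⟨u, huK, hua⟩ := hD a (Finset.mem_insert_self a D)
    refine ⟨l ++ l.map (· * u), by simp [hl], fun w hw => ?_, fun x hx => ?_⟩
    · rcases List.mem_append.1 hw with hw | hw
      · exact hlK w hw
      · obtain ⟨v, hv, rfl⟩ := List.mem_map.1 hw
        exact K.mul_mem (hlK v hv) huK
    · rw [List.countP_append, List.countP_map, List.length_append, List.length_map]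
      by_cases hux : (u : X → H) x = 1
      · have hxD : x ∈ D := (Finset.mem_insert.1 hx).resolve_left (by rintro rfl; exact hua hux)
        have hcongr : (fun w : FinSuppSubgroup H X => decide ((w : X → H) x = 1)) ∘ (· * u) =
            fun w : FinSuppSubgroup H X => decide ((w : X → H) x = 1) := by
          ext w; simp [hux]
        rw [hcongr]
        have := hlD x hxD
        omega
      · have hle : l.countP ((fun w : FinSuppSubgroup H X => decide ((w : X → H) x = 1)) ∘
            (· * u)) ≤ l.countP (fun w : FinSuppSubgroup H X =>
              ¬ decide ((w : X → H) x = 1)) := by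
          refine List.countP_mono_left fun w _ hw => ?_
          simp only [comp_apply, decide_eq_true_eq, Subgroup.coe_mul, Pi.mul_apply] at hw ⊢
          intro h
          exact hux (by simpa [h] using hw)
        have := List.length_eq_countP_add_countP
          (fun w : FinSuppSubgroup H X => decide ((w : X → H) x = 1)) (l := l)
        omega

theorem card_le_of_ncard_mulSupport_le (K : Subgroup (FinSuppSubgroup H X)) (N : ℕ)
    (hN : ∀ w ∈ K, (mulSupport (w : X → H)).ncard ≤ N) (D : Finset X)
    (hD : ∀ x ∈ D, ∃ w ∈ K, (w : X → H) x ≠ 1) : D.card ≤ 2 * N := by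
  classical
  obtain ⟨l, hl, hlK, hlD⟩ := exists_list_two_mul_countP_le K D hD
  have hcount (l : List (FinSuppSubgroup H X)) (hlK : ∀ w ∈ l, w ∈ K) :
      D.card * l.length ≤
        l.length * N + ∑ x ∈ D, l.countP (fun w : FinSuppSubgroup H X => (w : X → H) x = 1) := by
    induction l with
    | nil => simp
    | cons w l ih =>
      have h1 := ih fun v hv => hlK v (List.mem_cons_of_mem _ hv)
      have h2 : (D.filter fun x => (w : X → H) x ≠ 1).card ≤ N := by
        refine le_trans ?_ (hN w (hlK w List.mem_cons_self))
        rw [← Set.ncard_coe_finset]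
        exact Set.ncard_le_ncard (fun x hx => (Finset.mem_filter.1 hx).2) w.2
      have h3 := Finset.card_filter_add_card_filter_not (s := D) (fun x => (w : X → H) x = 1)
      simp only [List.countP_cons, Finset.sum_add_distrib, List.length_cons, decide_eq_true_eq,
        ← Finset.card_filter]
      nlinarith
  have h1 := hcount l hlK
  have h2 : ∑ x ∈ D, 2 * l.countP (fun w : FinSuppSubgroup H X => (w : X → H) x = 1) ≤ D.card * l.length := by
    simpa using Finset.sum_le_sum hlD
  rw [← Finset.mul_sum] at h2
  have hpos : 0 < l.length := List.length_pos_iff.2 hl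
  refine Nat.le_of_mul_le_mul_right (c := l.length) ?_ hpos
  nlinarith

theorem exists_finset_mulSupport_subset (K : Subgroup (FinSuppSubgroup H X)) (N : ℕ)
    (hN : ∀ w ∈ K, (mulSupport (w : X → H)).ncard ≤ N) :
    ∃ C : Finset X, ∀ w ∈ K, mulSupport (w : X → H) ⊆ C := by
  have hfin : {x : X | ∃ w ∈ K, (w : X → H) x ≠ 1}.Finite := by
    by_contra hinf
    obtain ⟨D, hD, hcard⟩ := Set.Infinite.exists_subset_card_eq hinf (2 * N + 1)
    have := card_le_of_ncard_mulSupport_le K N hN D fun x hx => hD hx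
    omega
  exact ⟨hfin.toFinset, fun w hw x hx => hfin.mem_toFinset.2 ⟨w, hw, hx⟩⟩

end FinSuppSubgroup

theorem RelPropT.finsum_bounded {H G X : Type*} [Group H] [Group G] [MulAction G X]
    {S : Set (FinSuppSubgroup H X)}
    (h : RelPropT (PermWreath H X G)
      ((SemidirectProduct.inl : FinSuppSubgroup H X →* PermWreath H X G) '' S))
    {ψ : H → ℝ} (hψ : IsCNDFunction ψ) :
    ∃ M : ℝ, ∀ w ∈ S, ∑ᶠ x, ψ ((w : X → H) x) ≤ M := by
  obtain ⟨M, hM⟩ := h _ (PermWreath.isCNDFunction_finsum hψ)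
  exact ⟨M, fun w hw => hM _ ⟨w, hw, rfl⟩⟩

theorem RelPropT.exists_finset_of_permWreath {H G X : Type*} [Group H] [Group G] [MulAction G X]
    {K : Subgroup (FinSuppSubgroup H X)}
    (h : RelPropT (PermWreath H X G)
      ((SemidirectProduct.inl : FinSuppSubgroup H X →* PermWreath H X G) ''
        (K : Set (FinSuppSubgroup H X)))) :
    ∃ C : Finset X, ∀ w ∈ K, mulSupport (w : X → H) ⊆ C := by
  classical
  obtain ⟨M, hM⟩ := h.finsum_bounded (isCNDFunction_indicator_ne_one H)
  refine FinSuppSubgroup.exists_finset_mulSupport_subset K ⌊M⌋₊ fun w hw => Nat.le_floor ?_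
  have hfin : (mulSupport (w : X → H)).Finite := w.2
  refine le_of_eq_of_le ?_ (hM w hw)
  rw [finsum_eq_sum_of_support_subset (s := hfin.toFinset),
    Set.ncard_eq_toFinset_card _ hfin]
  · rw [Finset.sum_congr rfl fun x hx => if_neg (hfin.mem_toFinset.1 hx)]
    simp
  · intro x hx
    simpa using hx

theorem RelPropT.coordinate_of_permWreath {H G X : Type*} [Group H] [Group G] [MulAction G X]
    {S : Set (FinSuppSubgroup H X)}
    (h : RelPropT (PermWreath H X G)
      ((SemidirectProduct.inl : FinSuppSubgroup H X →* PermWreath H X G) '' S)) (x : X) :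
    RelPropT H ((fun w : FinSuppSubgroup H X => (w : X → H) x) '' S) := by
  intro ψ hψ
  obtain ⟨M, hM⟩ := h.finsum_bounded hψ
  refine ⟨M, ?_⟩
  rintro _ ⟨w, hw, rfl⟩
  refine le_trans (single_le_finsum x ?_ fun y => hψ.nonneg_s16 _) (hM w hw)
  refine Set.Finite.subset w.2 fun y hy hwy => hy ?_
  simp only [hwy, hψ.map_one]

/-- **Proposition.** For a subgroup `K` of `W = H^{(X)}` inside the permutational wreath
product `H ≀_X G`, the following are equivalent: (i) `(W,K)` has relative Property (T);
(ii) `(H ≀_X G, K)` has relative Property (T); (iii) there is a finite `C ⊆ X` with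
`K ⊆ H^C` and `(H, p_x(K))` has relative Property (T) for every `x ∈ C`. -/
theorem perm_wreath_subgroup_relative_T {H G X : Type*} [Group H] [Group G]
    [Countable H] [Countable G] [Countable X] [Nonempty X] [MulAction G X]
    (K : Subgroup (FinSuppSubgroup H X)) :
    (RelPropT (FinSuppSubgroup H X) (K : Set (FinSuppSubgroup H X)) ↔
      RelPropT (PermWreath H X G)
        ((SemidirectProduct.inl : FinSuppSubgroup H X →* PermWreath H X G) ''
          (K : Set (FinSuppSubgroup H X)))) ∧
    (RelPropT (FinSuppSubgroup H X) (K : Set (FinSuppSubgroup H X)) ↔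
      ∃ C : Finset X,
        (∀ w ∈ K, Function.mulSupport ((w : X → H)) ⊆ (C : Set X)) ∧
        ∀ x ∈ C, RelPropT H
          ((fun w : FinSuppSubgroup H X => (w : X → H) x) ''
            (K : Set (FinSuppSubgroup H X)))) := by
  have h12 (h : RelPropT (FinSuppSubgroup H X) (K : Set (FinSuppSubgroup H X))) :
      RelPropT (PermWreath H X G)
        ((SemidirectProduct.inl : FinSuppSubgroup H X →* PermWreath H X G) ''
          (K : Set (FinSuppSubgroup H X))) :=
    h.image_hom _
  have h23 (h : RelPropT (PermWreath H X G)
        ((SemidirectProduct.inl : FinSuppSubgroup H X →* PermWreath H X G) ''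
          (K : Set (FinSuppSubgroup H X)))) :
      ∃ C : Finset X,
        (∀ w ∈ K, Function.mulSupport ((w : X → H)) ⊆ (C : Set X)) ∧
        ∀ x ∈ C, RelPropT H
          ((fun w : FinSuppSubgroup H X => (w : X → H) x) ''
            (K : Set (FinSuppSubgroup H X))) := by
    obtain ⟨C, hC⟩ := h.exists_finset_of_permWreath
    exact ⟨C, hC, fun x _ => h.coordinate_of_permWreath x⟩
  have h31 (h : ∃ C : Finset X,
        (∀ w ∈ K, Function.mulSupport ((w : X → H)) ⊆ (C : Set X)) ∧
        ∀ x ∈ C, RelPropT H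
          ((fun w : FinSuppSubgroup H X => (w : X → H) x) ''
            (K : Set (FinSuppSubgroup H X)))) :
      RelPropT (FinSuppSubgroup H X) (K : Set (FinSuppSubgroup H X)) := by
    obtain ⟨C, hC, hT⟩ := h
    intro ψ hψ
    obtain ⟨M, hM⟩ := FinSuppSubgroup.bddAbove_of_forall_coordinate hψ _ C hT
    exact ⟨M, fun w hw => hM w (hC w hw) fun x _ => ⟨w, hw, rfl⟩⟩
  exact ⟨⟨h12, fun h => h31 (h23 h)⟩, ⟨fun h => h23 (h12 h), h31⟩⟩
end
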